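/- Let A_x, A_y, A_z, B_x, B_y, B_z be n×n real matrices, and suppose for each ∗ ∈ {x,y,z} there is an n×n matrix S_∗ and a diagonal matrix Λ_∗ with S_∗ᵀ A_∗ S_∗ = Λ_∗ and S_∗ᵀ B_∗ S_∗ = I. Set Ā = B_z⊗B_y⊗A_x + B_z⊗A_y⊗B_x + A_z⊗B_y⊗B_x and D = I⊗I⊗Λ_x + I⊗Λ_y⊗I + Λ_z⊗I⊗I. If D is invertible, then Ā is invertible and Ā⁻¹ = (S_z ⊗ S_y ⊗ S_x) D⁻¹ (S_zᵀ ⊗ S_yᵀ ⊗ S_xᵀ) (the fast diagonalization method inverse). -/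

import Mathlib

open Matrix Kronecker

/-- If a product `P * A * K` of square matrices is invertible, then so is `A`, and its inverse is
`K * (P * A * K)⁻¹ * P`. -/
theorem Matrix.isUnit_and_inv_eq_of_mul_mul_eq {m R : Type*} [Fintype m] [DecidableEq m]
    [CommRing R] {P A K D : Matrix m m R} (h : P * A * K = D) (hD : IsUnit D) :
    IsUnit A ∧ A⁻¹ = K * D⁻¹ * P := by
  have hdet : IsUnit D.det := (Matrix.isUnit_iff_isUnit_det D).mp hD
  have hP : P * (A * K * D⁻¹) = 1 := by
    rw [← Matrix.mul_assoc, ← Matrix.mul_assoc, h, Matrix.mul_nonsing_inv D hdet]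
  have hA : A * (K * D⁻¹ * P) = 1 := by
    have := mul_eq_one_comm.mp hP
    simpa only [Matrix.mul_assoc] using this
  exact ⟨IsUnit.of_mul_eq_one _ hA, Matrix.inv_eq_right_inv hA⟩

/-- The fast diagonalization method inverse: if `Sᵀ A_∗ S = Λ_∗` (diagonal) and
`Sᵀ B_∗ S = I` for `∗ ∈ {x,y,z}` and `D = I⊗I⊗Λ_x + I⊗Λ_y⊗I + Λ_z⊗I⊗I` is
invertible, then the separable operator `Ā` is invertible with
`Ā⁻¹ = (S_z ⊗ S_y ⊗ S_x) D⁻¹ (S_zᵀ ⊗ S_yᵀ ⊗ S_xᵀ)`. -/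
theorem stmt_4 (n : ℕ) (Ax Ay Az Bx By Bz Sx Sy Sz Lx Ly Lz : Matrix (Fin n) (Fin n) ℝ)
    (hLx : Lx.IsDiag) (hLy : Ly.IsDiag) (hLz : Lz.IsDiag)
    (hAx : Sxᵀ * Ax * Sx = Lx) (hAy : Syᵀ * Ay * Sy = Ly) (hAz : Szᵀ * Az * Sz = Lz)
    (hBx : Sxᵀ * Bx * Sx = 1) (hBy : Syᵀ * By * Sy = 1) (hBz : Szᵀ * Bz * Sz = 1)
    (hD : IsUnit ((1 ⊗ₖ 1) ⊗ₖ Lx + (1 ⊗ₖ Ly) ⊗ₖ 1 + (Lz ⊗ₖ 1) ⊗ₖ 1 :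
        Matrix ((Fin n × Fin n) × Fin n) ((Fin n × Fin n) × Fin n) ℝ)) :
    IsUnit ((Bz ⊗ₖ By) ⊗ₖ Ax + (Bz ⊗ₖ Ay) ⊗ₖ Bx + (Az ⊗ₖ By) ⊗ₖ Bx) ∧
    ((Bz ⊗ₖ By) ⊗ₖ Ax + (Bz ⊗ₖ Ay) ⊗ₖ Bx + (Az ⊗ₖ By) ⊗ₖ Bx)⁻¹ =
      ((Sz ⊗ₖ Sy) ⊗ₖ Sx) *
        ((1 ⊗ₖ 1) ⊗ₖ Lx + (1 ⊗ₖ Ly) ⊗ₖ 1 + (Lz ⊗ₖ 1) ⊗ₖ 1)⁻¹ *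
        ((Szᵀ ⊗ₖ Syᵀ) ⊗ₖ Sxᵀ) := by
  refine Matrix.isUnit_and_inv_eq_of_mul_mul_eq ?_ hD
  simp only [Matrix.mul_add, Matrix.add_mul, ← Matrix.mul_kronecker_mul, hAx, hAy, hAz, hBx, hBy,
    hBz]
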